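/- arXiv:2204.06636 — 2 statements merged into one kernel-verified Lean document; each statement's English description precedes it below -/
import Mathlib

section
/- Let $\Omega \subsetneq \mathbb{R}^n$ be an open set, $s \in (0,1)$, $p \in (1,\infty)$ with $sp > 1$. Then there is a constant $C = C(n,s,p) > 0$, independent of $\Omega$, such that for all $u \in C^\infty_c(\Omega)$, $\int_{\mathbb{R}^n}\int_{\mathbb{R}^n}\frac{|u(x)-u(y)|^p}{|x-y|^{n+sp}}\,dx\,dy \le C\int_{\Omega}\int_{\Omega}\frac{|u(x)-u(y)|^p}{|x-y|^{n+sp}}\,dx\,dy$. -/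
open MeasureTheory Metric Set
open scoped ENNReal

abbrev EE (n : ℕ) := EuclideanSpace ℝ (Fin n)

noncomputable def kk (n : ℕ) (q : ℝ) (h : EE n) : ℝ≥0∞ :=
  ENNReal.ofReal (1 / ‖h‖ ^ ((n : ℝ) + q))

def QQ {n : ℕ} (Ω : Set (EE n)) : Set (EE n × EE n) :=
  {z | ∃ θ ∈ Set.Icc (0:ℝ) 1, z.1 + θ • z.2 ∉ Ω}

noncomputable def UQ {n : ℕ} (u : EE n → ℝ) (p : ℝ) (Ω : Set (EE n)) (z : EE n × EE n) : ℝ≥0∞ :=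
  (QQ Ω).indicator (fun z => ENNReal.ofReal (|u z.1| ^ p)) z

noncomputable def TT {n : ℕ} (u : EE n → ℝ) (p : ℝ) (z : EE n × EE n) : ℝ≥0∞ :=
  ENNReal.ofReal (|u z.1 - u (z.1 + z.2)| ^ p)

def OO {n : ℕ} (Ω : Set (EE n)) : Set (EE n × EE n) := {z | z.1 ∈ Ω ∧ z.1 + z.2 ∈ Ω}

noncomputable def DD {n : ℕ} (u : EE n → ℝ) (p : ℝ) (Ω : Set (EE n)) (z : EE n × EE n) : ℝ≥0∞ :=
  (OO Ω).indicator (TT u p) z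

noncomputable def JJ {n : ℕ} (q : ℝ) (G : EE n × EE n → ℝ≥0∞) : ℝ≥0∞ :=
  ∫⁻ h, kk n q h * ∫⁻ x, G (x, h)

lemma kk_meas (n : ℕ) (q : ℝ) : Measurable (kk n q) := by
  unfold kk; fun_prop

lemma QQ_closed {n : ℕ} {Ω : Set (EE n)} (hΩ : IsOpen Ω) : IsClosed (QQ Ω) := by
  have : QQ Ω = Prod.fst '' {w : (EE n × EE n) × Set.Icc (0:ℝ) 1 |
      w.1.1 + (w.2 : ℝ) • w.1.2 ∈ Ωᶜ} := by
    ext z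
    constructor
    · rintro ⟨θ, h1, h2⟩
      exact ⟨(z, ⟨θ, h1⟩), h2, rfl⟩
    · rintro ⟨⟨z', θ⟩, h2, rfl⟩
      exact ⟨θ.1, θ.2, h2⟩
  rw [this]
  apply isClosedMap_fst_of_compactSpace
  apply hΩ.isClosed_compl.preimage
  fun_prop

lemma UQ_meas {n : ℕ} {u : EE n → ℝ} (hu : Continuous u) (p : ℝ) {Ω : Set (EE n)}
    (hΩ : IsOpen Ω) : Measurable (UQ u p Ω) := by
  unfold UQ
  apply Measurable.indicator _ (QQ_closed hΩ).measurableSet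
  have := hu.measurable
  fun_prop

lemma TT_meas {n : ℕ} {u : EE n → ℝ} (hu : Continuous u) (p : ℝ) : Measurable (TT u p) := by
  unfold TT
  have := hu.measurable
  fun_prop

lemma OO_open {n : ℕ} {Ω : Set (EE n)} (hΩ : IsOpen Ω) : IsOpen (OO Ω) :=
  (hΩ.preimage continuous_fst).inter (hΩ.preimage (continuous_fst.add continuous_snd))

lemma DD_meas {n : ℕ} {u : EE n → ℝ} (hu : Continuous u) (p : ℝ) {Ω : Set (EE n)}
    (hΩ : IsOpen Ω) : Measurable (DD u p Ω) :=
  (TT_meas hu p).indicator (OO_open hΩ).measurableSet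

lemma JJ_meas {n : ℕ} {q : ℝ} {G : EE n × EE n → ℝ≥0∞} (hG : Measurable G) :
    Measurable (fun h => kk n q h * ∫⁻ x, G (x, h)) :=
  (kk_meas n q).mul hG.lintegral_prod_left'

lemma JJ_add {n : ℕ} {q : ℝ} {G H : EE n × EE n → ℝ≥0∞} (hG : Measurable G) :
    JJ q (fun z => G z + H z) = JJ q G + JJ q H := by
  unfold JJ
  rw [← lintegral_add_left (JJ_meas hG)]
  congr 1; ext h
  rw [lintegral_add_left (by fun_prop), mul_add]

lemma JJ_mul {n : ℕ} {q : ℝ} {G : EE n × EE n → ℝ≥0∞} (c : ℝ≥0∞) (hG : Measurable G) :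
    JJ q (fun z => c * G z) = c * JJ q G := by
  unfold JJ
  rw [← lintegral_const_mul _ (JJ_meas hG)]
  congr 1; ext h
  rw [lintegral_const_mul _ (by fun_prop)]
  ring

lemma JJ_mono {n : ℕ} {q : ℝ} {G H : EE n × EE n → ℝ≥0∞} (h : ∀ z, G z ≤ H z) :
    JJ q G ≤ JJ q H :=
  lintegral_mono fun y => mul_le_mul_right (lintegral_mono fun x => h (x, y)) _

/-- translation invariance -/
lemma JJ_trans {n : ℕ} {q : ℝ} {G : EE n × EE n → ℝ≥0∞} :
    JJ q (fun z => G (z.1 + z.2, z.2)) = JJ q G := by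
  unfold JJ
  congr 1; ext h
  congr 1
  exact lintegral_add_right_eq_self (fun x => G (x, h)) h

lemma JJ_flip {n : ℕ} {q : ℝ} {G : EE n × EE n → ℝ≥0∞} :
    JJ q (fun z => G (z.1 + z.2, -z.2)) = JJ q G := by
  unfold JJ
  have : ∀ h : EE n, ∫⁻ x, G (x + h, -h) = ∫⁻ x, G (x, -h) := fun h =>
    lintegral_add_right_eq_self (fun x => G (x, -h)) h
  simp only [this]
  rw [← lintegral_neg_eq_self (fun h => kk n q h * ∫⁻ x, G (x, h))]
  simp [kk]

lemma kk_scale {n : ℕ} {q : ℝ} (h : EE n) :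
    kk n q ((2:ℝ) • h) = ENNReal.ofReal ((2:ℝ) ^ (-((n:ℝ) + q))) * kk n q h := by
  unfold kk
  rw [← ENNReal.ofReal_mul (by positivity), norm_smul, Real.mul_rpow (by positivity) (by positivity),
    Real.rpow_neg (by norm_num)]
  congr 1
  rw [one_div, one_div, mul_inv]
  norm_num

/-- scaling -/
lemma JJ_scale {n : ℕ} {q : ℝ} {G : EE n × EE n → ℝ≥0∞} (hG : Measurable G) :
    JJ q (fun z => G (z.1, (1/2:ℝ) • z.2)) = ENNReal.ofReal ((2:ℝ) ^ (-q)) * JJ q G := by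
  unfold JJ
  have h1 := lintegral_map (μ := (volume : Measure (EE n)))
    (JJ_meas (q := q) (G := fun z => G (z.1, (1/2:ℝ) • z.2)) (by fun_prop))
    (measurable_const_smul (2:ℝ))
  rw [Measure.map_addHaar_smul _ (by norm_num : (2:ℝ) ≠ 0), lintegral_smul_measure] at h1
  simp only [smul_smul, kk_scale] at h1
  norm_num at h1
  have h2 : ∀ h : EE n, ENNReal.ofReal ((2:ℝ) ^ (-q + -(n:ℝ))) * kk n q h * ∫⁻ x, G (x, h)
     = ENNReal.ofReal ((2:ℝ) ^ (-q + -(n:ℝ))) * (kk n q h * ∫⁻ x, G (x, h)) := fun h => mul_assoc _ _ _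
  simp only [h2] at h1
  rw [lintegral_const_mul _ (JJ_meas hG)] at h1
  have e2 : ENNReal.ofReal ((2:ℝ) ^ (-q + -(n:ℝ))) = (2^n)⁻¹ * ENNReal.ofReal ((2:ℝ) ^ (-q)) := by
    rw [Real.rpow_add (by norm_num), mul_comm, ENNReal.ofReal_mul (by positivity),
      Real.rpow_neg (by norm_num), ENNReal.ofReal_inv_of_pos (by positivity), Real.rpow_natCast,
      ENNReal.ofReal_pow (by norm_num)]
    norm_num
  rw [e2, mul_assoc] at h1
  exact (ENNReal.mul_right_inj (by simp) (by simp)).1 h1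

lemma conv_ineq {p t a b : ℝ} (hp : 1 ≤ p) (ht : 0 < t) (ht1 : t < 1) :
    |a| ^ p ≤ t ^ (1 - p) * |b| ^ p + (1 - t) ^ (1 - p) * |a - b| ^ p := by
  have h1t : 0 < 1 - t := by linarith
  have hc := (convexOn_rpow hp).2 (x := |b| / t) (y := |a - b| / (1 - t))
    (by simp; positivity) (by simp; positivity) ht.le h1t.le (by ring)
  simp only [smul_eq_mul] at hc
  rw [mul_div_cancel₀ _ ht.ne', mul_div_cancel₀ _ h1t.ne', Real.div_rpow (by positivity) ht.le,
    Real.div_rpow (by positivity) h1t.le] at hc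
  have h3 : |a| ^ p ≤ (|b| + |a - b|) ^ p := by
    apply Real.rpow_le_rpow (by positivity) _ (by linarith)
    have := abs_add_le b (a - b)
    simpa using this
  refine h3.trans (hc.trans (le_of_eq ?_))
  rw [Real.rpow_sub ht, Real.rpow_sub h1t, Real.rpow_one, Real.rpow_one]
  ring

lemma pt1 {n : ℕ} {u : EE n → ℝ} {p t : ℝ} {Ω : Set (EE n)} (hp : 1 ≤ p) (ht : 0 < t) (ht1 : t < 1)
    (x h : EE n) :
    UQ u p Ω (x, (2:ℝ) • h) ≤ UQ u p Ω (x, h) + (ENNReal.ofReal (t ^ (1 - p)) * UQ u p Ω (x + h, h)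
      + ENNReal.ofReal ((1 - t) ^ (1 - p)) * DD u p Ω (x, h)) := by
  by_cases h1 : (x, h) ∈ QQ Ω
  · refine le_trans ?_ le_self_add
    rw [UQ, UQ, indicator_of_mem h1]
    exact indicator_le_self' (by simp) _
  by_cases h2 : (x, (2:ℝ) • h) ∈ QQ Ω
  swap
  · rw [UQ, indicator_of_notMem h2]; exact zero_le
  refine le_trans ?_ le_add_self
  have hx : x ∈ Ω := by
    by_contra hx
    exact h1 ⟨0, by simp, by simpa using hx⟩
  have hxh : x + h ∈ Ω := by
    by_contra hx
    exact h1 ⟨1, by simp, by simpa using hx⟩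
  have h3 : (x + h, h) ∈ QQ Ω := by
    obtain ⟨θ, ⟨h0, h1'⟩, hθ⟩ := h2
    rcases le_or_gt θ (1/2) with hh | hh
    · exact absurd ⟨2 * θ, ⟨by linarith, by linarith⟩, by
        simpa [smul_smul, mul_comm] using hθ⟩ h1
    · refine ⟨2 * θ - 1, ⟨by linarith, by linarith⟩, ?_⟩
      convert hθ using 2
      simp only
      module
  have h4 : (x, h) ∈ OO Ω := ⟨hx, hxh⟩
  rw [UQ, UQ, DD, indicator_of_mem h2, indicator_of_mem h3, indicator_of_mem h4, TT,
    ← ENNReal.ofReal_mul (by positivity), ← ENNReal.ofReal_mul (Real.rpow_nonneg (by linarith) _),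
    ← ENNReal.ofReal_add (by positivity) (mul_nonneg (Real.rpow_nonneg (by linarith) _) (by positivity))]
  exact ENNReal.ofReal_le_ofReal (conv_ineq hp ht ht1)

lemma pt2 {n : ℕ} {u : EE n → ℝ} {p : ℝ} {Ω : Set (EE n)} 
    (hu : ∀ x, x ∉ Ω → u x = 0) (z : EE n × EE n) :
    TT u p z ≤ DD u p Ω z + (UQ u p Ω z + UQ u p Ω (z.1 + z.2, -z.2)) := by
  by_cases hx : z.1 ∈ Ω
  · by_cases hy : z.1 + z.2 ∈ Ω
    · refine le_trans ?_ le_self_add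
      rw [DD, indicator_of_mem (show z ∈ OO Ω from ⟨hx, hy⟩)]
    · refine le_trans (le_trans ?_ le_self_add) le_add_self
      rw [UQ, indicator_of_mem (show z ∈ QQ Ω from ⟨1, by simp, by simpa using hy⟩), TT, hu _ hy]
      simp
  · refine le_trans (le_trans ?_ le_add_self) le_add_self
    rw [UQ, indicator_of_mem (show (z.1 + z.2, -z.2) ∈ QQ Ω from ⟨1, by simp, by simpa using hx⟩),
      TT, hu _ hx]
    simp

lemma hardy {n : ℕ} {u : EE n → ℝ} {p q t : ℝ} {Ω : Set (EE n)} (hp : 1 ≤ p) (ht : 0 < t)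
    (ht1 : t < 1) (hu : Continuous u) (hΩ : IsOpen Ω) :
    JJ q (UQ u p Ω) ≤ ENNReal.ofReal ((2:ℝ) ^ (-q)) * (JJ q (UQ u p Ω)
      + (ENNReal.ofReal (t ^ (1 - p)) * JJ q (UQ u p Ω)
      + ENNReal.ofReal ((1 - t) ^ (1 - p)) * JJ q (DD u p Ω))) := by
  have hU := UQ_meas hu p hΩ
  have hD := DD_meas hu p hΩ
  have e : JJ q (UQ u p Ω) ≤ JJ q (fun z => (fun z : EE n × EE n => UQ u p Ω z +
      (ENNReal.ofReal (t ^ (1 - p)) * UQ u p Ω (z.1 + z.2, z.2)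
      + ENNReal.ofReal ((1 - t) ^ (1 - p)) * DD u p Ω z)) (z.1, (1/2:ℝ) • z.2)) := by
    apply JJ_mono
    rintro ⟨x, h⟩
    have := pt1 (u := u) (Ω := Ω) hp ht ht1 x ((1/2:ℝ) • h)
    simpa [smul_smul] using this
  refine e.trans (le_of_eq ?_)
  rw [JJ_scale (G := fun z : EE n × EE n => UQ u p Ω z +
      (ENNReal.ofReal (t ^ (1 - p)) * UQ u p Ω (z.1 + z.2, z.2)
      + ENNReal.ofReal ((1 - t) ^ (1 - p)) * DD u p Ω z)) (by fun_prop), JJ_add hU, JJ_add (by fun_prop), JJ_mul _ hD,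
    JJ_mul _ (G := fun z => UQ u p Ω (z.1 + z.2, z.2)) (by fun_prop), JJ_trans]

lemma full {n : ℕ} {u : EE n → ℝ} {p q : ℝ} {Ω : Set (EE n)} 
    (hu : Continuous u) (hΩ : IsOpen Ω) (hu0 : ∀ x, x ∉ Ω → u x = 0) :
    JJ q (TT u p) ≤ JJ q (DD u p Ω) + (JJ q (UQ u p Ω) + JJ q (UQ u p Ω)) := by
  have hU := UQ_meas hu p hΩ
  have hD := DD_meas hu p hΩ
  refine (JJ_mono (pt2 hu0)).trans (le_of_eq ?_)
  rw [JJ_add hD, JJ_add hU, JJ_flip]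

lemma far_fin {n : ℕ} {q δ : ℝ} (hq : 0 < q) (hδ : 0 < δ) :
    ∫⁻ h in {h : EE n | δ ≤ ‖h‖}, kk n q h < ⊤ := by
  have h1 := finite_integral_one_add_norm (E := EE n) (μ := volume) (r := (n:ℝ) + q) (by simpa using hq)
  have hms : MeasurableSet {h : EE n | δ ≤ ‖h‖} := measurableSet_le measurable_const measurable_norm
  have h2 : ∀ h ∈ {h : EE n | δ ≤ ‖h‖}, kk n q h ≤ ENNReal.ofReal ((1 + 1/δ) ^ ((n:ℝ) + q)) *
      ENNReal.ofReal ((1 + ‖h‖) ^ (-((n:ℝ) + q))) := by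
    intro h (hh : δ ≤ ‖h‖)
    have hpos : 0 < ‖h‖ := hδ.trans_le hh
    rw [kk, ← ENNReal.ofReal_mul (by positivity)]
    apply ENNReal.ofReal_le_ofReal
    rw [Real.rpow_neg (by positivity), ← div_eq_mul_inv, ← Real.div_rpow (by positivity) (by positivity),
      ← Real.one_rpow ((n:ℝ) + q), ← Real.div_rpow (by positivity) (by positivity), Real.one_rpow]
    apply Real.rpow_le_rpow (by positivity) _ (by positivity)
    rw [div_le_div_iff₀ hpos (by positivity)]
    have : 1 ≤ ‖h‖ / δ := by rwa [le_div_iff₀ hδ, one_mul]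
    have e : (1 + 1/δ) * ‖h‖ = ‖h‖ + ‖h‖ / δ := by ring
    rw [e]; linarith
  refine (setLIntegral_mono' hms h2).trans_lt ?_
  refine (setLIntegral_le_lintegral _ _).trans_lt ?_
  rw [lintegral_const_mul _ (by fun_prop)]
  exact ENNReal.mul_lt_top (by simp) h1

lemma UQ_fin {n : ℕ} {u : EE n → ℝ} {p q : ℝ} {Ω : Set (EE n)} (hp : 1 ≤ p) (hq : 0 < q)
    (hu : Continuous u) (hc : HasCompactSupport u) (hΩ : IsOpen Ω) (hs : tsupport u ⊆ Ω) :
    JJ q (UQ u p Ω) < ⊤ := by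
  obtain ⟨δ, hδ, hth⟩ := IsCompact.exists_thickening_subset_open hc hΩ hs
  obtain ⟨M, hM⟩ := hc.exists_bound_of_continuous hu
  have hms : MeasurableSet {h : EE n | δ ≤ ‖h‖} := measurableSet_le measurable_const measurable_norm
  have hK : MeasurableSet (tsupport u) := (isClosed_tsupport u).measurableSet
  have h1 : ∀ z : EE n × EE n, UQ u p Ω z ≤ {h : EE n | δ ≤ ‖h‖}.indicator 1 z.2 *
      (tsupport u).indicator (fun _ => ENNReal.ofReal (M ^ p)) z.1 := by
    rintro ⟨x, h⟩
    by_cases hx : x ∈ tsupport u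
    swap
    · have : u x = 0 := image_eq_zero_of_notMem_tsupport hx
      have : UQ u p Ω (x, h) = 0 := by
        simp [UQ, indicator, this, Real.zero_rpow (by linarith : p ≠ 0)]
      rw [this]; exact zero_le
    by_cases hQ : (x, h) ∈ QQ Ω
    swap
    · rw [UQ, indicator_of_notMem hQ]; exact zero_le
    have hh : δ ≤ ‖h‖ := by
      by_contra hh
      push Not at hh
      obtain ⟨θ, ⟨h0, h1'⟩, hθ⟩ := hQ
      apply hθ
      apply hth
      rw [mem_thickening_iff]
      refine ⟨x, hx, ?_⟩
      simp only [dist_self_add_left, norm_smul, Real.norm_eq_abs, abs_of_nonneg h0]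
      nlinarith [norm_nonneg h]
    rw [UQ, indicator_of_mem hQ, indicator_of_mem hx, indicator_of_mem (by exact hh)]
    simp only [Pi.one_apply, one_mul]
    apply ENNReal.ofReal_le_ofReal
    exact Real.rpow_le_rpow (by positivity) (hM x) (by linarith)
  refine (JJ_mono h1).trans_lt ?_
  unfold JJ
  have hf := far_fin (n := n) hq hδ
  have e : ∀ h : EE n, kk n q h * ∫⁻ x, ({h : EE n | δ ≤ ‖h‖}.indicator 1 h *
      (tsupport u).indicator (fun _ => ENNReal.ofReal (M ^ p)) x) =
      {h : EE n | δ ≤ ‖h‖}.indicator (kk n q) h * (ENNReal.ofReal (M ^ p) * volume (tsupport u)) := by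
    intro h
    rw [lintegral_const_mul _ (measurable_const.indicator hK), lintegral_indicator hK,
      setLIntegral_const, ← mul_assoc]
    congr 1
    by_cases hh : δ ≤ ‖h‖ <;> simp [indicator, hh]
  simp only [e]
  rw [lintegral_mul_const _ ((kk_meas n q).indicator hms), lintegral_indicator hms]
  exact ENNReal.mul_lt_top hf (ENNReal.mul_lt_top (by simp) hc.isCompact.measure_lt_top)

lemma near_fin {n : ℕ} (hn : n ≠ 0) {p q L : ℝ} (hq : 0 < q) (hqp : q < p) (hL : 0 ≤ L) :
    ∫⁻ h in ball (0 : EE n) 1, kk n q h * ENNReal.ofReal ((L * ‖h‖) ^ p) < ⊤ := by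
  have h1 : IntegrableOn (fun h : EE n => 1 / ‖h‖ ^ ((n : ℝ) + q) * (L * ‖h‖) ^ p) (ball 0 1)
      volume := by
    refine integrableOn_ball_of_norm_le_rpow (C := L ^ p) (α := (n:ℝ) + q - p) ?_ ?_ ?_ ?_
    · simp; omega
    · simp; linarith
    · refine Filter.Eventually.of_forall fun h => ?_
      rw [Real.norm_of_nonneg (by positivity), Real.mul_rpow hL (by positivity)]
      by_cases hh : h = 0
      · simp only [hh, norm_zero]
        rw [Real.zero_rpow (by positivity), Real.zero_rpow (by linarith)]
        simp
        positivity
      · have : 0 < ‖h‖ := norm_pos_iff.2 hh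
        rw [neg_sub, Real.rpow_sub this]
        apply le_of_eq
        ring
    · apply Measurable.aestronglyMeasurable
      fun_prop
  have h2 := h1.lintegral_lt_top
  refine lt_of_eq_of_lt ?_ h2
  congr 1
  ext h
  rw [kk, ENNReal.ofReal_mul (by positivity)]

lemma TT_fin {n : ℕ} (hn : n ≠ 0) {u : EE n → ℝ} {p q : ℝ} (hp : 1 ≤ p) (hq : 0 < q) (hqp : q < p)
    (hu : ContDiff ℝ (⊤ : ℕ∞) u) (hc : HasCompactSupport u) :
    JJ q (TT u p) < ⊤ := by
  obtain ⟨L, hL⟩ := hu.lipschitzWith_of_hasCompactSupport hc (by simp)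
  obtain ⟨M, hM⟩ := hc.exists_bound_of_continuous hu.continuous
  have hK : MeasurableSet (tsupport u) := (isClosed_tsupport u).measurableSet
  let m : EE n → ℝ≥0∞ := fun h => if ‖h‖ < 1 then ENNReal.ofReal ((L * ‖h‖) ^ p) else
    ENNReal.ofReal ((M + M) ^ p)
  have hmm : Measurable m :=
    Measurable.ite (measurableSet_lt measurable_norm measurable_const) (by fun_prop) (by fun_prop)
  have hm : ∀ z : EE n × EE n, ENNReal.ofReal (|u z.1 - u (z.1 + z.2)| ^ p) ≤ m z.2 := by
    rintro ⟨x, h⟩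
    simp only [m]
    split_ifs with hh
    · apply ENNReal.ofReal_le_ofReal
      apply Real.rpow_le_rpow (by positivity) _ (by linarith)
      have := hL.dist_le_mul x (x + h)
      simpa [Real.dist_eq] using this
    · apply ENNReal.ofReal_le_ofReal
      apply Real.rpow_le_rpow (by positivity) _ (by linarith)
      have h1 := hM x
      have h2 := hM (x + h)
      simp only [Real.norm_eq_abs] at h1 h2
      have := abs_sub (u x) (u (x + h))
      linarith
  have h1 : ∀ z : EE n × EE n, TT u p z ≤ m z.2 *
      ((tsupport u).indicator 1 z.1 + (tsupport u).indicator 1 (z.1 + z.2)) := by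
    rintro ⟨x, h⟩
    by_cases hx : x ∈ tsupport u
    · rw [indicator_of_mem hx]
      refine (hm _).trans ?_
      simp [mul_add]
    by_cases hy : x + h ∈ tsupport u
    · rw [indicator_of_mem (a := x + h) hy]
      refine (hm _).trans ?_
      simp [mul_add]
    have e1 : u x = 0 := image_eq_zero_of_notMem_tsupport hx
    have e2 : u (x + h) = 0 := image_eq_zero_of_notMem_tsupport hy
    simp [TT, e1, e2, Real.zero_rpow (by linarith : p ≠ 0)]
  refine (JJ_mono h1).trans_lt ?_
  unfold JJ
  have e : ∀ h : EE n, kk n q h * ∫⁻ x, (m h *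
      ((tsupport u).indicator 1 x + (tsupport u).indicator 1 (x + h))) =
      (kk n q h * m h) * (volume (tsupport u) + volume (tsupport u)) := by
    intro h
    rw [lintegral_const_mul, lintegral_add_left (measurable_one.indicator hK),
      lintegral_add_right_eq_self (fun x => (tsupport u).indicator (1 : EE n → ℝ≥0∞) x) h,
      lintegral_indicator_one hK, mul_assoc]
    have := measurable_one.indicator (β := ℝ≥0∞) hK
    fun_prop
  simp only [e]
  rw [lintegral_mul_const _ (by have := kk_meas n q; fun_prop)]
  refine ENNReal.mul_lt_top ?_ (by simp [hc.isCompact.measure_lt_top])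
  rw [← lintegral_add_compl _ (measurableSet_ball (x := (0 : EE n)) (ε := 1))]
  refine ENNReal.add_lt_top.2 ⟨?_, ?_⟩
  · refine lt_of_eq_of_lt ?_ (near_fin hn hq hqp L.2)
    apply setLIntegral_congr_fun measurableSet_ball
    intro h hh
    simp only [mem_ball_zero_iff] at hh
    simp [m, hh]
  · have hf := far_fin (n := n) hq one_pos
    have : (ball (0 : EE n) 1)ᶜ = {h : EE n | 1 ≤ ‖h‖} := by
      ext h; simp
    rw [this]
    have e3 : ∫⁻ h in {h : EE n | 1 ≤ ‖h‖}, kk n q h * m h =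
        ∫⁻ h in {h : EE n | 1 ≤ ‖h‖}, kk n q h * ENNReal.ofReal ((M + M) ^ p) := by
      apply setLIntegral_congr_fun (measurableSet_le measurable_const measurable_norm)
      intro h hh
      have : ¬ ‖h‖ < 1 := not_lt.2 hh
      simp [m, this]
    rw [e3, lintegral_mul_const _ (kk_meas n q)]
    exact ENNReal.mul_lt_top hf (by simp)

lemma bridge {n : ℕ} {q : ℝ} {F G : EE n × EE n → ℝ≥0∞} (hF : Measurable F) (hG : Measurable G)
    (h : ∀ x h, F (x, x + h) = kk n q h * G (x, h)) :
    ∫⁻ z, F z ∂(volume.prod volume) = JJ q G := by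
  rw [lintegral_prod _ hF.aemeasurable]
  have e : ∀ x : EE n, ∫⁻ y, F (x, y) = ∫⁻ h, kk n q h * G (x, h) := by
    intro x
    rw [← lintegral_add_left_eq_self (fun y => F (x, y)) x]
    simp only [h]
  simp only [e]
  have := kk_meas n q
  rw [lintegral_lintegral_swap (by unfold Function.uncurry; fun_prop)]
  unfold JJ
  congr 1; ext h
  rw [lintegral_const_mul _ (by fun_prop)]

theorem seminorm_comparable (n : ℕ) (s p : ℝ)
    (hs : s ∈ Set.Ioo (0:ℝ) 1) (hp : 1 < p) (hsp : 1 < s * p) :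
    ∃ C : ℝ, 0 < C ∧
      ∀ Ω : Set (EuclideanSpace ℝ (Fin n)), IsOpen Ω → Ω ≠ Set.univ →
        ∀ u : EuclideanSpace ℝ (Fin n) → ℝ,
          ContDiff ℝ (⊤ : ℕ∞) u → HasCompactSupport u → tsupport u ⊆ Ω →
          (∫ x, ∫ y, |u x - u y| ^ p / dist x y ^ ((n : ℝ) + s * p))
            ≤ C * ∫ x in Ω, ∫ y in Ω, |u x - u y| ^ p / dist x y ^ ((n : ℝ) + s * p) := by
  rcases Nat.eq_zero_or_pos n with hn | hn
  · subst hn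
    refine ⟨1, one_pos, fun Ω _ hΩ u _ _ _ => ?_⟩
    have e : ∀ x y : EuclideanSpace ℝ (Fin 0), |u x - u y| ^ p / dist x y ^ (((0:ℕ) : ℝ) + s * p) = 0 := by
      intro x y
      rw [Subsingleton.elim x y]
      simp [Real.zero_rpow (by linarith : p ≠ 0)]
    simp only [e]
    simp
  set q := s * p with hqdef
  have hq : 0 < q := by linarith
  have hqp : q < p := by
    have := hs.2
    nlinarith
  -- constants
  set A : ℝ := 2 ^ (q - 1) with hA
  have hA1 : 1 < A := Real.one_lt_rpow (by norm_num) (by linarith)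
  have h2q : (2:ℝ) ^ (-q) = (2 * A)⁻¹ := by
    rw [Real.rpow_neg (by norm_num), hA, Real.rpow_sub (by norm_num)]
    norm_num
  set t : ℝ := A ^ (-(1 / (p - 1)) / 2) with ht
  have ht0 : 0 < t := by positivity
  have hp1 : 0 < p - 1 := by linarith
  have ht1 : t < 1 := by
    apply Real.rpow_lt_one_of_one_lt_of_neg hA1
    have : 0 < 1 / (p - 1) := by positivity
    linarith
  have hta : t ^ (1 - p) = A ^ (1/2 : ℝ) := by
    rw [ht, ← Real.rpow_mul (by positivity)]
    congr 1
    field_simp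
    ring
  set a : ℝ := t ^ (1 - p) with ha
  set b : ℝ := (1 - t) ^ (1 - p) with hb
  have hb0 : 0 < b := Real.rpow_pos_of_pos (by linarith) _
  have ha0 : 0 < a := by positivity
  have haA : a < A := by
    rw [hta]
    nth_rewrite 2 [← Real.rpow_one A]
    exact Real.rpow_lt_rpow_of_exponent_lt hA1 (by norm_num)
  have hgap : 0 < 2 * A - 1 - a := by linarith
  refine ⟨1 + 2 * (b / (2 * A - 1 - a)), by positivity, fun Ω hΩ _ u hu hc hsu => ?_⟩
  have huc := hu.continuous
  have hTf := TT_fin hn.ne' hp.le hq hqp hu hc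
  have hUf := UQ_fin hp.le hq huc hc hΩ hsu
  have hDf : JJ q (DD u p Ω) < ⊤ :=
    (JJ_mono (fun z => indicator_le_self' (by simp) z)).trans_lt hTf
  have hH := hardy (q := q) hp.le ht0 ht1 huc hΩ
  have hFu := full (q := q) (p := p) huc hΩ
    (fun x hx => image_eq_zero_of_notMem_tsupport (fun h => hx (hsu h)))
  let f : EE n × EE n → ℝ := fun z => |u z.1 - u z.2| ^ p / dist z.1 z.2 ^ ((n : ℝ) + q)
  have hf0 : ∀ z, 0 ≤ f z := fun z => by positivity
  have hfm : Measurable f := by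
    have := huc.measurable
    fun_prop
  have hfk : ∀ x h, ENNReal.ofReal (f (x, x + h)) = kk n q h * TT u p (x, h) := by
    intro x h
    simp only [f, kk, TT, dist_self_add_right]
    rw [← ENNReal.ofReal_mul (by positivity)]
    congr 1
    ring
  have b1 : ∫⁻ z, ENNReal.ofReal (f z) ∂(volume.prod volume) = JJ q (TT u p) :=
    bridge (by fun_prop) (TT_meas huc p) hfk
  have hΩΩ : MeasurableSet (Ω ×ˢ Ω) := hΩ.measurableSet.prod hΩ.measurableSet
  have b2 : ∫⁻ z in Ω ×ˢ Ω, ENNReal.ofReal (f z) ∂(volume.prod volume) = JJ q (DD u p Ω) := by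
    rw [← lintegral_indicator hΩΩ]
    apply bridge (Measurable.indicator (by fun_prop) hΩΩ) (DD_meas huc p hΩ)
    intro x h
    by_cases hh : x ∈ Ω ∧ x + h ∈ Ω
    · rw [indicator_of_mem (by exact hh), DD, indicator_of_mem (by exact hh), hfk]
    · rw [indicator_of_notMem (by exact hh), DD, indicator_of_notMem (by exact hh), mul_zero]
  have hint : Integrable f (volume.prod volume) := by
    refine ⟨hfm.aestronglyMeasurable, ?_⟩
    rw [hasFiniteIntegral_iff_ofReal (Filter.Eventually.of_forall hf0), b1]
    exact hTf
  have i1 : (∫ x, ∫ y, |u x - u y| ^ p / dist x y ^ ((n : ℝ) + q)) = (JJ q (TT u p)).toReal := by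
    rw [← b1, ← integral_eq_lintegral_of_nonneg_ae (Filter.Eventually.of_forall hf0)
      hfm.aestronglyMeasurable, integral_prod _ hint]
  have i2 : (∫ x in Ω, ∫ y in Ω, |u x - u y| ^ p / dist x y ^ ((n : ℝ) + q))
      = (JJ q (DD u p Ω)).toReal := by
    rw [← b2, ← integral_eq_lintegral_of_nonneg_ae (Filter.Eventually.of_forall hf0)
      hfm.aestronglyMeasurable, setIntegral_prod _ hint.integrableOn]
  rw [i1, i2]
  have hF' := ENNReal.toReal_mono (by finiteness) hFu
  have hH' := ENNReal.toReal_mono (by finiteness) hH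
  rw [ENNReal.toReal_add (by finiteness) (by finiteness),
    ENNReal.toReal_add (by finiteness) (by finiteness)] at hF'
  rw [ENNReal.toReal_mul, ENNReal.toReal_add (by finiteness) (by finiteness),
    ENNReal.toReal_add (by finiteness) (by finiteness), ENNReal.toReal_mul, ENNReal.toReal_mul,
    ENNReal.toReal_ofReal (by positivity), ENNReal.toReal_ofReal ha0.le,
    ENNReal.toReal_ofReal hb0.le, h2q] at hH'
  generalize (JJ q (UQ u p Ω)).toReal = W at *
  generalize (JJ q (DD u p Ω)).toReal = D at *
  have h3 : 2 * A * W ≤ W + (a * W + b * D) := by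
    rwa [inv_mul_eq_div, le_div_iff₀ (by positivity), mul_comm] at hH'
  have h4 : W ≤ b / (2 * A - 1 - a) * D := by
    rw [div_mul_eq_mul_div, le_div_iff₀ hgap]
    linarith
  linarith
end

section
/- Let $\Omega \subsetneq \mathbb{R}^n$ be a nonempty open set, $0 < s < 1$, $p > 1$ with $sp > n$. Then there is a constant $C > 0$, independent of $u$, such that for all $u \in C^\infty_c(\Omega)$, $\int_{\Omega}\frac{|u(x)|^p}{\delta(x)^{sp}}\,dx \le C\int_{\mathbb{R}^n}\int_{\mathbb{R}^n}\frac{|u(x)-u(y)|^p}{|x-y|^{n+sp}}\,dx\,dy$, where $\delta(x) = \mathrm{dist}(x, \Omega^c)$. -/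
open MeasureTheory Metric Set

lemma hardy_scaling {n : ℕ} {q a : ℝ} (hq : (n : ℝ) < q) (ha : 0 < a)
    (y : EuclideanSpace ℝ (Fin n)) :
    ∫⁻ x : EuclideanSpace ℝ (Fin n), ENNReal.ofReal ((a + dist x y) ^ (-q))
      = ENNReal.ofReal (a ^ ((n : ℝ) - q) * ∫ x : EuclideanSpace ℝ (Fin n), (1 + ‖x‖) ^ (-q)) := by
  have hint : Integrable (fun x : EuclideanSpace ℝ (Fin n) => (1 + ‖x‖) ^ (-q)) :=
    integrable_one_add_norm (by simpa using hq)
  have e1 : ∀ x : EuclideanSpace ℝ (Fin n), (a + ‖x‖) ^ (-q)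
      = a ^ (-q) * (1 + ‖a⁻¹ • x‖) ^ (-q) := by
    intro x
    rw [← Real.mul_rpow ha.le (by positivity), norm_smul, norm_inv, Real.norm_of_nonneg ha.le]
    congr 1
    field_simp
  have hint2 : Integrable (fun x : EuclideanSpace ℝ (Fin n) => (a + ‖x‖) ^ (-q)) := by
    simp_rw [e1]
    exact (hint.comp_smul (inv_ne_zero ha.ne')).const_mul _
  simp_rw [dist_eq_norm]
  rw [lintegral_sub_right_eq_self (fun x => ENNReal.ofReal ((a + ‖x‖) ^ (-q))) y,
    ← ofReal_integral_eq_lintegral_ofReal hint2 (Filter.Eventually.of_forall fun x => by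
      simp only [Pi.zero_apply]; positivity)]
  congr 1
  simp_rw [e1]
  rw [integral_const_mul,
    Measure.integral_comp_inv_smul volume
      (fun x : EuclideanSpace ℝ (Fin n) => (1 + ‖x‖) ^ (-q)) a]
  rw [finrank_euclideanSpace_fin, abs_of_pos (by positivity), smul_eq_mul, ← mul_assoc,
    sub_eq_neg_add, Real.rpow_add ha, Real.rpow_natCast]

lemma hardy_pow_add {a b p : ℝ} (hp : 0 < p) :
    |a| ^ p ≤ 2 ^ p * (|a - b| ^ p + |b| ^ p) := by
  have h1 : |a| ≤ 2 * max |a - b| |b| := by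
    have : |a| ≤ |a - b| + |b| := by simpa using abs_add_le (a - b) b
    linarith [le_max_left |a - b| |b|, le_max_right |a - b| |b|]
  have hm : (0:ℝ) ≤ max |a - b| |b| := le_max_of_le_right (abs_nonneg _)
  calc |a| ^ p ≤ (2 * max |a - b| |b|) ^ p := Real.rpow_le_rpow (abs_nonneg _) h1 hp.le
    _ = 2 ^ p * (max |a - b| |b|) ^ p := Real.mul_rpow (by norm_num) hm
    _ ≤ _ := by
      gcongr
      rcases max_choice |a - b| |b| with h | h <;> rw [h]
      · have : 0 ≤ |b| ^ p := by positivity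
        linarith
      · have : 0 ≤ |a - b| ^ p := by positivity
        linarith

/-- pointwise inequality -/
lemma hardy_pointwise {n : ℕ} {p q l : ℝ} (hp : 0 < p) (hq : 0 < q)
    (hl : 0 < l) (hl2 : l ≤ 1 / 2) {S : Set (EuclideanSpace ℝ (Fin n))}
    {x x0 y : EuclideanSpace ℝ (Fin n)} (hx0 : x0 ∈ S) (hd : infDist x S = dist x x0)
    (hpos : 0 < infDist x S) (hy : y ∈ ball x0 (l * infDist x S)) (a b : ℝ) :
    |a| ^ p / infDist x S ^ q ≤ 2 ^ p * 2 ^ q * (|a - b| ^ p / dist x y ^ q)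
      + 2 ^ p * 4 ^ q * (|b| ^ p * (infDist y S / l + dist x y) ^ (-q)) := by
  set d := infDist x S with hdd
  have hy' : dist y x0 < l * d := hy
  have hld : l * d ≤ d / 2 := by nlinarith
  have t1 := dist_triangle x y x0
  have t2 := dist_triangle x x0 y
  rw [dist_comm x0 y] at t2
  have h1 : d / 2 ≤ dist x y := by linarith
  have h2 : dist x y ≤ 2 * d := by linarith
  have h3 : infDist y S / l ≤ d := by
    rw [div_le_iff₀ hl]
    have := infDist_le_dist_of_mem (x := y) hx0
    linarith
  have h30 : 0 ≤ infDist y S / l := div_nonneg infDist_nonneg hl.le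
  have hxy : 0 < dist x y := by linarith
  have hA : 1 / d ^ q ≤ 2 ^ q * (1 / dist x y ^ q) := by
    rw [mul_one_div, div_le_div_iff₀ (by positivity) (by positivity), one_mul,
      ← Real.mul_rpow (by norm_num) hpos.le]
    exact Real.rpow_le_rpow hxy.le h2 hq.le
  have hB : 1 / d ^ q ≤ 4 ^ q * (infDist y S / l + dist x y) ^ (-q) := by
    rw [Real.rpow_neg (by positivity), ← div_eq_mul_inv,
      div_le_div_iff₀ (by positivity) (by positivity), one_mul,
      ← Real.mul_rpow (by norm_num) hpos.le]
    exact Real.rpow_le_rpow (by positivity) (by linarith) hq.le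
  have h0 := hardy_pow_add (a := a) (b := b) hp
  calc |a| ^ p / d ^ q = |a| ^ p * (1 / d ^ q) := by ring
    _ ≤ 2 ^ p * (|a - b| ^ p + |b| ^ p) * (1 / d ^ q) := by gcongr
    _ = 2 ^ p * (|a - b| ^ p * (1 / d ^ q)) + 2 ^ p * (|b| ^ p * (1 / d ^ q)) := by ring
    _ ≤ 2 ^ p * (|a - b| ^ p * (2 ^ q * (1 / dist x y ^ q)))
        + 2 ^ p * (|b| ^ p * (4 ^ q * (infDist y S / l + dist x y) ^ (-q))) := by gcongr
    _ = _ := by ring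

lemma hardy_kernel {n : ℕ} (hn : 0 < n) {s p A B : ℝ} (hs : 0 < s) (hs1 : s < 1) (hp : 0 < p) :
    Integrable (fun z : EuclideanSpace ℝ (Fin n) =>
      (if ‖z‖ < 1 then A * ‖z‖ ^ (p - ((n:ℝ) + s * p)) else B * ‖z‖ ^ (-((n:ℝ) + s * p)))) := by
  have : Nonempty (Fin n) := ⟨⟨0, hn⟩⟩
  have hsp : 0 < s * p := mul_pos hs hp
  rw [integrable_fun_norm_addHaar volume (f := fun r : ℝ =>
    (if r < 1 then A * r ^ (p - ((n:ℝ) + s * p)) else B * r ^ (-((n:ℝ) + s * p))))]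
  rw [finrank_euclideanSpace_fin]
  have hc : ∀ y : ℝ, 0 < y → y ^ (n - 1) = y ^ ((n:ℝ) - 1) := by
    intro y hy
    rw [← Real.rpow_natCast, Nat.cast_sub hn, Nat.cast_one]
  rw [← Ioo_union_Ici_eq_Ioi (zero_lt_one' ℝ)]
  refine IntegrableOn.union ?_ ?_
  · have : IntegrableOn (fun y : ℝ => A * y ^ (p - s * p - 1)) (Ioo 0 1) := by
      refine Integrable.const_mul ?_ _
      have := (intervalIntegral.intervalIntegrable_rpow' (a := 0) (b := 1)
        (r := p - s * p - 1) (by nlinarith)).1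
      exact this.mono_set Ioo_subset_Ioc_self
    refine this.congr_fun (fun y hy => ?_) measurableSet_Ioo
    simp only [smul_eq_mul, if_pos hy.2]
    rw [hc y hy.1, mul_left_comm, ← Real.rpow_add hy.1]
    congr 2; ring
  · have : IntegrableOn (fun y : ℝ => B * y ^ (-1 - s * p)) (Ici 1) := by
      rw [integrableOn_Ici_iff_integrableOn_Ioi]
      exact Integrable.const_mul (integrableOn_Ioi_rpow_of_lt (by linarith) one_pos) _
    refine this.congr_fun (fun y hy => ?_) measurableSet_Ici
    have hy0 : 0 < y := lt_of_lt_of_le one_pos hy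
    simp only [smul_eq_mul, if_neg (not_lt.2 (mem_Ici.1 hy))]
    rw [hc y hy0, mul_left_comm, ← Real.rpow_add hy0]
    congr 2; ring

lemma hardy_energy {n : ℕ} (hn : 0 < n) {s p : ℝ} (hs : 0 < s) (hs1 : s < 1) (hp : 0 < p)
    {u : EuclideanSpace ℝ (Fin n) → ℝ} (hu : ContDiff ℝ (⊤ : ℕ∞) u) (hc : HasCompactSupport u) :
    Integrable (fun z : EuclideanSpace ℝ (Fin n) × EuclideanSpace ℝ (Fin n) =>
      |u z.1 - u z.2| ^ p / dist z.1 z.2 ^ ((n : ℝ) + s * p)) (volume.prod volume) := by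
  obtain ⟨L, hL⟩ := hu.lipschitzWith_of_hasCompactSupport hc (by simp)
  obtain ⟨M, hM⟩ := hc.exists_bound_of_continuous hu.continuous
  have hsp : 0 < s * p := mul_pos hs hp
  have hM0 : 0 ≤ M := (norm_nonneg _).trans (hM 0)
  have hum : Measurable u := hu.continuous.measurable
  have hmeas : Measurable (fun z : EuclideanSpace ℝ (Fin n) × EuclideanSpace ℝ (Fin n) =>
      |u z.1 - u z.2| ^ p / dist z.1 z.2 ^ ((n : ℝ) + s * p)) := by
    have h1 : Measurable (fun z : EuclideanSpace ℝ (Fin n) × EuclideanSpace ℝ (Fin n) =>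
      |u z.1 - u z.2|) := by
      exact (continuous_abs.measurable).comp ((hum.comp measurable_fst).sub (hum.comp measurable_snd))
    exact (h1.pow_const p).div ((measurable_fst.dist measurable_snd).pow_const _)
  set k : EuclideanSpace ℝ (Fin n) → ℝ := fun z =>
      (if ‖z‖ < 1 then (L:ℝ) ^ p * ‖z‖ ^ (p - ((n:ℝ) + s * p))
        else (2 * M) ^ p * ‖z‖ ^ (-((n:ℝ) + s * p))) with hk
  have hki : Integrable k := hardy_kernel hn hs hs1 hp
  set K := tsupport u with hK
  have hKi : Integrable (K.indicator (fun _ => (1:ℝ))) :=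
    (integrable_indicator_iff (isClosed_tsupport u).measurableSet).2
      (integrableOn_const (hc.isCompact.measure_lt_top.ne))
  have hG1 : Integrable (fun z : EuclideanSpace ℝ (Fin n) × EuclideanSpace ℝ (Fin n) =>
      K.indicator (fun _ => (1:ℝ)) z.2 * k (z.1 - z.2)) (volume.prod volume) :=
    hKi.convolution_integrand (ContinuousLinearMap.mul ℝ ℝ) hki
  have hkn : ∀ z, k (-z) = k z := fun z => by simp [hk]
  have hG2 : Integrable (fun z : EuclideanSpace ℝ (Fin n) × EuclideanSpace ℝ (Fin n) =>
      K.indicator (fun _ => (1:ℝ)) z.1 * k (z.1 - z.2)) (volume.prod volume) := by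
    refine hG1.swap.congr (Filter.Eventually.of_forall fun z => ?_)
    simp only [Function.comp, Prod.fst_swap, Prod.snd_swap]
    rw [← hkn, neg_sub]
  refine (hG1.add hG2).mono' hmeas.aestronglyMeasurable (Filter.Eventually.of_forall fun z => ?_)
  obtain ⟨x, y⟩ := z
  have hk0 : 0 ≤ k (x - y) := by
    simp only [hk]; split_ifs <;> positivity
  have hF : |u x - u y| ^ p / dist x y ^ ((n : ℝ) + s * p) ≤ k (x - y) := by
    rcases eq_or_ne x y with rfl | hne
    · simpa [Real.zero_rpow hp.ne'] using hk0
    have hd : 0 < ‖x - y‖ := norm_pos_iff.2 (sub_ne_zero.2 hne)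
    rw [dist_eq_norm]
    simp only [hk]
    split_ifs
    · rw [Real.rpow_sub hd, ← mul_div_assoc]
      gcongr
      rw [← Real.mul_rpow (NNReal.coe_nonneg L) hd.le]
      refine Real.rpow_le_rpow (abs_nonneg _) ?_ hp.le
      have := hL.dist_le_mul x y
      rwa [Real.dist_eq, dist_eq_norm] at this
    · rw [Real.rpow_neg hd.le, ← div_eq_mul_inv]
      gcongr
      have h1 := hM x
      have h2 := hM y
      rw [Real.norm_eq_abs] at h1 h2
      calc |u x - u y| ≤ |u x| + |u y| := abs_sub _ _
        _ ≤ 2 * M := by linarith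
  have hF0 : 0 ≤ |u x - u y| ^ p / dist x y ^ ((n : ℝ) + s * p) := by positivity
  simp only [Pi.add_apply]
  rw [Real.norm_of_nonneg hF0]
  by_cases hx : x ∈ K
  · by_cases hy : y ∈ K <;> simp only [hx, hy, indicator_of_mem, indicator_of_notMem, not_false_eq_true] <;> linarith
  · by_cases hy : y ∈ K
    · simp only [hx, hy, indicator_of_mem, indicator_of_notMem, not_false_eq_true]; linarith
    · have e1 : u x = 0 := image_eq_zero_of_notMem_tsupport hx
      have e2 : u y = 0 := image_eq_zero_of_notMem_tsupport hy
      simp [hx, hy, e1, e2, Real.zero_rpow hp.ne']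

lemma hardy_lhs_int {n : ℕ} {t p : ℝ} (hp : 0 < p)
    {Ω : Set (EuclideanSpace ℝ (Fin n))} (hΩ : IsOpen Ω) (hne : Ωᶜ.Nonempty)
    {u : EuclideanSpace ℝ (Fin n) → ℝ} (hu : Continuous u) (hc : HasCompactSupport u)
    (hsub : tsupport u ⊆ Ω) :
    Integrable (fun x => |u x| ^ p / infDist x Ωᶜ ^ t) := by
  have hsup : HasCompactSupport (fun x => |u x| ^ p / infDist x Ωᶜ ^ t) := by
    refine hc.mono fun x hx => ?_
    rw [Function.mem_support] at hx ⊢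
    intro h
    simp [h, Real.zero_rpow hp.ne'] at hx
  refine Continuous.integrable_of_hasCompactSupport ?_ hsup
  rw [continuous_iff_continuousAt]
  intro x
  by_cases hx : x ∈ tsupport u
  · have hpos : 0 < infDist x Ωᶜ := by
      rw [← hΩ.isClosed_compl.notMem_iff_infDist_pos hne]
      simpa using hsub hx
    refine ContinuousAt.div ?_ ?_ (by positivity)
    · exact (hu.abs.continuousAt).rpow_const (Or.inr hp.le)
    · exact (continuous_infDist_pt _).continuousAt.rpow_const (Or.inl hpos.ne')
  · have : (fun x => |u x| ^ p / infDist x Ωᶜ ^ t) =ᶠ[nhds x] fun _ => 0 := by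
      rw [notMem_tsupport_iff_eventuallyEq] at hx
      filter_upwards [hx] with z hz
      simp [hz, Real.zero_rpow hp.ne']
    exact continuousAt_const.congr this.symm

set_option maxHeartbeats 1000000 in
lemma hardy_main {n : ℕ} (hn : 0 < n) {t p l : ℝ} (ht : 0 < t) (hp : 0 < p)
    (hl : 0 < l) (hl2 : l ≤ 1 / 2)
    {Ω : Set (EuclideanSpace ℝ (Fin n))} (hΩ : IsOpen Ω) (hne : Ωᶜ.Nonempty)
    {u : EuclideanSpace ℝ (Fin n) → ℝ} (hu : Continuous u) (hsub : tsupport u ⊆ Ω) :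
    ENNReal.ofReal (l ^ n) * volume (ball (0 : EuclideanSpace ℝ (Fin n)) 1) *
      (∫⁻ x in Ω, ENNReal.ofReal (|u x| ^ p / infDist x Ωᶜ ^ t)) ≤
    ENNReal.ofReal (2 ^ p * 2 ^ ((n:ℝ) + t)) *
      (∫⁻ x, ∫⁻ y, ENNReal.ofReal (|u x - u y| ^ p / dist x y ^ ((n : ℝ) + t)))
    + ENNReal.ofReal (2 ^ p * 4 ^ ((n:ℝ) + t) * (l ^ t *
        ∫ x : EuclideanSpace ℝ (Fin n), (1 + ‖x‖) ^ (-((n:ℝ) + t)))) *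
      (∫⁻ x in Ω, ENNReal.ofReal (|u x| ^ p / infDist x Ωᶜ ^ t)) := by
  have : Nonempty (Fin n) := ⟨⟨0, hn⟩⟩
  set q : ℝ := (n:ℝ) + t with hqdef
  have hn0 : (0:ℝ) ≤ n := Nat.cast_nonneg n
  have hq : 0 < q := by positivity
  have hum : Measurable u := hu.measurable
  set J := ∫ x : EuclideanSpace ℝ (Fin n), (1 + ‖x‖) ^ (-q) with hJ
  have hJ0 : 0 ≤ J := integral_nonneg fun x => by positivity
  have hposΩ : ∀ x ∈ Ω, 0 < infDist x Ωᶜ := fun x hx => by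
    rw [← hΩ.isClosed_compl.notMem_iff_infDist_pos hne]
    simpa using hx
  have hzero : ∀ x, x ∉ Ω → u x = 0 := fun x hx =>
    image_eq_zero_of_notMem_tsupport fun h => hx (hsub h)
  have hF : Measurable (fun z : EuclideanSpace ℝ (Fin n) × EuclideanSpace ℝ (Fin n) =>
      ENNReal.ofReal (|u z.1 - u z.2| ^ p / dist z.1 z.2 ^ q)) := by
    have h1 : Measurable (fun z : EuclideanSpace ℝ (Fin n) × EuclideanSpace ℝ (Fin n) =>
      |u z.1 - u z.2|) := by
      exact (continuous_abs.measurable).comp ((hum.comp measurable_fst).sub (hum.comp measurable_snd))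
    exact ((h1.pow_const p).div ((measurable_fst.dist measurable_snd).pow_const _)).ennreal_ofReal
  have hG : Measurable (fun z : EuclideanSpace ℝ (Fin n) × EuclideanSpace ℝ (Fin n) =>
      ENNReal.ofReal (|u z.2| ^ p * (infDist z.2 Ωᶜ / l + dist z.1 z.2) ^ (-q))) := by
    have h1 : Measurable (fun z : EuclideanSpace ℝ (Fin n) × EuclideanSpace ℝ (Fin n) =>
      |u z.2|) := (continuous_abs.measurable).comp (hum.comp measurable_snd)
    have h2 : Measurable (fun z : EuclideanSpace ℝ (Fin n) × EuclideanSpace ℝ (Fin n) =>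
      infDist z.2 Ωᶜ / l) := ((continuous_infDist_pt _).measurable.comp measurable_snd).div_const l
    exact ((h1.pow_const p).mul
      ((h2.add (measurable_fst.dist measurable_snd)).pow_const _)).ennreal_ofReal
  have hptw : ∀ x ∈ Ω,
      ENNReal.ofReal (l ^ n) * volume (ball (0 : EuclideanSpace ℝ (Fin n)) 1) *
        ENNReal.ofReal (|u x| ^ p / infDist x Ωᶜ ^ t) ≤
      ENNReal.ofReal (2 ^ p * 2 ^ q) * (∫⁻ y, ENNReal.ofReal (|u x - u y| ^ p / dist x y ^ q)) +
      ENNReal.ofReal (2 ^ p * 4 ^ q) * (∫⁻ y, ENNReal.ofReal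
        (|u y| ^ p * (infDist y Ωᶜ / l + dist x y) ^ (-q))) := by
    intro x hx
    obtain ⟨x0, hx0, hd⟩ := hΩ.isClosed_compl.exists_infDist_eq_dist hne x
    have hpos := hposΩ x hx
    have hFx : Measurable (fun y => ENNReal.ofReal (|u x - u y| ^ p / dist x y ^ q)) :=
      hF.comp (measurable_prodMk_left (x := x))
    have hGx : Measurable (fun y => ENNReal.ofReal
        (|u y| ^ p * (infDist y Ωᶜ / l + dist x y) ^ (-q))) :=
      hG.comp (measurable_prodMk_left (x := x))
    rw [← lintegral_const_mul _ hFx, ← lintegral_const_mul _ hGx,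
      ← lintegral_add_left (hFx.const_mul _)]
    calc _ = ∫⁻ y in ball x0 (l * infDist x Ωᶜ), ENNReal.ofReal (|u x| ^ p / infDist x Ωᶜ ^ q) := by
          rw [setLIntegral_const, Measure.addHaar_ball volume x0
              (r := l * infDist x Ωᶜ) (by positivity), finrank_euclideanSpace_fin,
            ← mul_assoc, ← ENNReal.ofReal_mul (by positivity), mul_right_comm,
            ← ENNReal.ofReal_mul (by positivity)]
          congr 2
          rw [hqdef, Real.rpow_add hpos, Real.rpow_natCast, mul_pow]
          field_simp
      _ ≤ ∫⁻ y in ball x0 (l * infDist x Ωᶜ), (ENNReal.ofReal (2 ^ p * 2 ^ q) *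
            ENNReal.ofReal (|u x - u y| ^ p / dist x y ^ q) +
            ENNReal.ofReal (2 ^ p * 4 ^ q) *
            ENNReal.ofReal (|u y| ^ p * (infDist y Ωᶜ / l + dist x y) ^ (-q))) := by
          refine setLIntegral_mono' measurableSet_ball fun y hy => ?_
          have h0 : 0 ≤ infDist y Ωᶜ / l := div_nonneg infDist_nonneg hl.le
          rw [← ENNReal.ofReal_mul (by positivity), ← ENNReal.ofReal_mul (by positivity),
            ← ENNReal.ofReal_add (by positivity) (by positivity)]
          exact ENNReal.ofReal_le_ofReal
            (hardy_pointwise hp hq hl hl2 hx0 hd hpos hy (u x) (u y))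
      _ ≤ _ := setLIntegral_le_lintegral _ _
  have hFi : Measurable (fun x => ∫⁻ y, ENNReal.ofReal (|u x - u y| ^ p / dist x y ^ q)) :=
    hF.lintegral_prod_right'
  have hGi : Measurable (fun x => ∫⁻ y, ENNReal.ofReal
        (|u y| ^ p * (infDist y Ωᶜ / l + dist x y) ^ (-q))) :=
    hG.lintegral_prod_right'
  have hLm : Measurable (fun x => ENNReal.ofReal (|u x| ^ p / infDist x Ωᶜ ^ t)) :=
    ((((continuous_abs.measurable).comp hum).pow_const p).div
      ((continuous_infDist_pt _).measurable.pow_const _)).ennreal_ofReal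
  have hinner : ∀ y, ∫⁻ x, ENNReal.ofReal (|u y| ^ p * (infDist y Ωᶜ / l + dist x y) ^ (-q))
      = Ω.indicator (fun y => ENNReal.ofReal (l ^ t * J) *
          ENNReal.ofReal (|u y| ^ p / infDist y Ωᶜ ^ t)) y := by
    intro y
    by_cases hy : y ∈ Ω
    · have hpos := hposΩ y hy
      rw [indicator_of_mem hy]
      simp_rw [ENNReal.ofReal_mul (show 0 ≤ |u y| ^ p by positivity)]
      rw [lintegral_const_mul' _ _ ENNReal.ofReal_ne_top,
        hardy_scaling (by linarith) (by positivity) y, ← ENNReal.ofReal_mul (by positivity),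
        ← ENNReal.ofReal_mul (by positivity)]
      congr 1
      rw [show (n:ℝ) - q = -t by rw [hqdef]; ring, Real.rpow_neg (by positivity),
        Real.div_rpow hpos.le hl.le, ← hJ]
      field_simp
    · rw [indicator_of_notMem hy, hzero y hy]
      simp [Real.zero_rpow hp.ne']
  calc _ = ∫⁻ x in Ω, ENNReal.ofReal (l ^ n) * volume (ball (0 : EuclideanSpace ℝ (Fin n)) 1) *
        ENNReal.ofReal (|u x| ^ p / infDist x Ωᶜ ^ t) := by
        rw [lintegral_const_mul _ hLm]
    _ ≤ ∫⁻ x in Ω, (ENNReal.ofReal (2 ^ p * 2 ^ q) *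
          (∫⁻ y, ENNReal.ofReal (|u x - u y| ^ p / dist x y ^ q)) +
        ENNReal.ofReal (2 ^ p * 4 ^ q) * (∫⁻ y, ENNReal.ofReal
        (|u y| ^ p * (infDist y Ωᶜ / l + dist x y) ^ (-q)))) :=
        setLIntegral_mono' hΩ.measurableSet hptw
    _ ≤ ∫⁻ x, (ENNReal.ofReal (2 ^ p * 2 ^ q) *
          (∫⁻ y, ENNReal.ofReal (|u x - u y| ^ p / dist x y ^ q)) +
        ENNReal.ofReal (2 ^ p * 4 ^ q) * (∫⁻ y, ENNReal.ofReal
        (|u y| ^ p * (infDist y Ωᶜ / l + dist x y) ^ (-q)))) := setLIntegral_le_lintegral _ _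
    _ = _ := by
        rw [lintegral_add_left (hFi.const_mul _), lintegral_const_mul _ hFi,
          lintegral_const_mul _ hGi]
        congr 1
        rw [lintegral_lintegral_swap hG.aemeasurable]
        simp_rw [hinner]
        rw [lintegral_indicator hΩ.measurableSet, lintegral_const_mul _ hLm, ← mul_assoc,
          ← ENNReal.ofReal_mul (by positivity)]

/-- Fractional `p`-Hardy inequality in the supercritical case `sp > n`. -/
theorem fractional_hardy_supercritical (n : ℕ) (s p : ℝ)
    (hs : s ∈ Set.Ioo (0:ℝ) 1) (hp : 1 < p) (hsp : (n : ℝ) < s * p)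
    (Ω : Set (EuclideanSpace ℝ (Fin n))) (hΩ : IsOpen Ω) (hΩne : Ω.Nonempty)
    (hΩprop : Ω ≠ Set.univ) :
    ∃ C : ℝ, 0 < C ∧
      ∀ u : EuclideanSpace ℝ (Fin n) → ℝ,
        ContDiff ℝ (⊤ : ℕ∞) u → HasCompactSupport u → tsupport u ⊆ Ω →
        (∫ x in Ω, |u x| ^ p / Metric.infDist x Ωᶜ ^ (s * p))
          ≤ C * ∫ x, ∫ y, |u x - u y| ^ p / dist x y ^ ((n : ℝ) + s * p) := by
  have hn : 0 < n := by
    rcases Nat.eq_zero_or_pos n with rfl | h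
    · exact absurd (Subsingleton.eq_univ_of_nonempty hΩne) hΩprop
    · exact h
  have hne : Ωᶜ.Nonempty := nonempty_compl.2 hΩprop
  have hp0 : 0 < p := by linarith
  have ht : 0 < s * p := mul_pos hs.1 hp0
  set t := s * p with htdef
  set q : ℝ := (n:ℝ) + t with hqdef
  set J := ∫ x : EuclideanSpace ℝ (Fin n), (1 + ‖x‖) ^ (-q) with hJ
  have hJ0 : 0 ≤ J := integral_nonneg fun x => by positivity
  set c := (volume (ball (0 : EuclideanSpace ℝ (Fin n)) 1)).toReal with hcdef
  have hc : 0 < c := ENNReal.toReal_pos (measure_ball_pos _ _ one_pos).ne' measure_ball_lt_top.ne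
  have hK : 0 < 2 * (2 ^ p * 4 ^ q * (J + 1)) := by positivity
  set l := min (1 / 2) ((c / (2 * (2 ^ p * 4 ^ q * (J + 1)))) ^ (1 / (t - n))) with hldef
  have hl : 0 < l := lt_min (by norm_num) (by positivity)
  have hl2 : l ≤ 1 / 2 := min_le_left _ _
  have htn : 0 < t - n := by linarith
  have hl3 : l ^ (t - n) ≤ c / (2 * (2 ^ p * 4 ^ q * (J + 1))) := by
    calc l ^ (t - n) ≤ ((c / (2 * (2 ^ p * 4 ^ q * (J + 1)))) ^ (1 / (t - n))) ^ (t - n) :=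
          Real.rpow_le_rpow hl.le (min_le_right _ _) htn.le
      _ = _ := by
          rw [← Real.rpow_mul (by positivity), one_div_mul_cancel htn.ne', Real.rpow_one]
  have hl4 : 2 ^ p * 4 ^ q * (l ^ t * J) ≤ l ^ n * c / 2 := by
    have e : l ^ t = l ^ (t - n) * l ^ n := by
      rw [← Real.rpow_natCast, ← Real.rpow_add hl]; congr 1; ring
    rw [le_div_iff₀ hK] at hl3
    have h1 : 2 ^ p * 4 ^ q * (l ^ t * J) ≤ 2 ^ p * 4 ^ q * (l ^ t * (J + 1)) := by
      gcongr; linarith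
    have h2 : 2 ^ p * 4 ^ q * (l ^ t * (J + 1)) =
      (l ^ (t - n) * (2 * (2 ^ p * 4 ^ q * (J + 1)))) * l ^ n / 2 := by rw [e]; ring
    have h3 : (l ^ (t - n) * (2 * (2 ^ p * 4 ^ q * (J + 1)))) * l ^ n ≤ c * l ^ n := by gcongr
    linarith
  refine ⟨2 * (2 ^ p * 2 ^ q) / (l ^ n * c), by positivity, fun u hu hcs hsub => ?_⟩
  have hE := hardy_energy hn hs.1 hs.2 hp0 hu hcs
  have hI := (hardy_lhs_int (t := t) hp0 hΩ hne hu.continuous hcs hsub).integrableOn (s := Ω)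
  have main := hardy_main hn ht hp0 hl hl2 hΩ hne hu.continuous hsub
  rw [← hqdef, ← hJ] at main
  have hnd : ∀ x, 0 ≤ infDist x Ωᶜ := fun _ => infDist_nonneg
  rw [← ofReal_integral_eq_lintegral_ofReal hI (Filter.Eventually.of_forall fun x => by
      have := hnd x
      simp only [Pi.zero_apply]; positivity)] at main
  have hEq : ∫⁻ x, ∫⁻ y, ENNReal.ofReal (|u x - u y| ^ p / dist x y ^ q)
      = ENNReal.ofReal (∫ x, ∫ y, |u x - u y| ^ p / dist x y ^ q) := by
    rw [← integral_prod (fun z : EuclideanSpace ℝ (Fin n) × EuclideanSpace ℝ (Fin n) =>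
        |u z.1 - u z.2| ^ p / dist z.1 z.2 ^ q) hE,
      ofReal_integral_eq_lintegral_ofReal hE (Filter.Eventually.of_forall fun x => by
        simp only [Pi.zero_apply]; positivity),
      lintegral_prod _ hE.1.aemeasurable.ennreal_ofReal]
  have hI0 : 0 ≤ ∫ x in Ω, |u x| ^ p / infDist x Ωᶜ ^ t := integral_nonneg fun x => by
    have := hnd x
    simp only [Pi.zero_apply]; positivity
  have hE0 : 0 ≤ ∫ x, ∫ y, |u x - u y| ^ p / dist x y ^ q :=
    integral_nonneg fun x => integral_nonneg fun y => by
      simp only [Pi.zero_apply]; positivity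
  rw [hEq, ← ENNReal.ofReal_toReal (measure_ball_lt_top (μ := volume)
    (x := (0 : EuclideanSpace ℝ (Fin n))) (r := 1)).ne, ← hcdef] at main
  generalize (∫ x in Ω, |u x| ^ p / infDist x Ωᶜ ^ t) = I at *
  generalize (∫ x, ∫ y, |u x - u y| ^ p / dist x y ^ q) = E at *
  rw [← ENNReal.ofReal_mul (by positivity), ← ENNReal.ofReal_mul (by positivity),
    ← ENNReal.ofReal_mul (by positivity), ← ENNReal.ofReal_mul (by positivity),
    ← ENNReal.ofReal_add (by positivity) (by positivity),
    ENNReal.ofReal_le_ofReal_iff (by positivity)] at main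
  have h5 := mul_le_mul_of_nonneg_right hl4 hI0
  rw [div_mul_eq_mul_div, le_div_iff₀ (by positivity)]
  linarith
end
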